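/- arXiv:1806.00245 — 6 statements merged into one kernel-verified Lean document; each statement's English description precedes it below -/
import Mathlib

section
/- Let ℓ ∈ ℕ and let K be the Legendre covariance kernel of degree ℓ. Then for every θ ∈ (0, π) and every φ ∈ ℝ, evaluating at the diagonal point θ₁ = θ₂ = θ, φ₁ = φ₂ = φ one has: (i) ∂²K/∂θ₁∂θ₂ = P_ℓ'(1); (ii) (1/sin θ) · ∂²K/∂θ₁∂φ₂ = 0; (iii) (1/sin²θ) · ∂²K/∂φ₁∂φ₂ = P_ℓ'(1). -/
open Real MeasureTheory

/-- The `l`-th Legendre polynomial, via Rodrigues' formula. -/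
noncomputable def legendre (l : ℕ) : ℝ → ℝ :=
  fun t => (1 / (2 ^ l * (Nat.factorial l : ℝ))) * iteratedDeriv l (fun s => (s ^ 2 - 1) ^ l) t

/-- The Legendre covariance kernel of degree `l`. -/
noncomputable def legendreKernel (l : ℕ) (θ₁ φ₁ θ₂ φ₂ : ℝ) : ℝ :=
  legendre l (Real.cos θ₁ * Real.cos θ₂ + Real.sin θ₁ * Real.sin θ₂ * Real.cos (φ₁ - φ₂))

theorem contDiff_legendre (l : ℕ) : ContDiff ℝ 2 (legendre l) := by
  have h : ContDiff ℝ (2 + l) (fun s : ℝ => (s ^ 2 - 1) ^ l) := by fun_prop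
  have h' := h.iterate_deriv' 2 l
  rw [← iteratedDeriv_eq_iterate] at h'
  exact contDiff_const.mul h'

/-- The mixed second derivative of `F (u x y)` at a point where `∂u/∂x` vanishes. -/
theorem deriv_deriv_comp_of_eq_zero {F : ℝ → ℝ} {u : ℝ → ℝ → ℝ} {v : ℝ → ℝ} {a b w m : ℝ}
    (hF : ContDiff ℝ 2 F) (hux : ∀ y, HasDerivAt (fun x => u x y) (v y) a)
    (hu : HasDerivAt (u a) w b) (hv : HasDerivAt v m b) (hvb : v b = 0) :
    deriv (fun y => deriv (fun x => F (u x y)) a) b = deriv F (u a b) * m := by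
  have hF1 : Differentiable ℝ F := hF.differentiable (by norm_num)
  have hF2 : Differentiable ℝ (deriv F) :=
    ((contDiff_succ_iff_deriv (n := 1)).1 hF).2.2.differentiable (by norm_num)
  have h (y : ℝ) : deriv (fun x => F (u x y)) a = deriv F (u a y) * v y :=
    ((hF1 (u a y)).hasDerivAt.comp a (hux y)).deriv
  simp_rw [h]
  have h' := (((hF2 (u a b)).hasDerivAt.comp b hu).mul hv).deriv
  rw [hvb, mul_zero, zero_add] at h'
  exact h'

theorem stmt0 (l : ℕ) (θ φ : ℝ) (hθ : θ ∈ Set.Ioo 0 Real.pi) :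
    deriv (fun θ₂ => deriv (fun θ₁ => legendreKernel l θ₁ φ θ₂ φ) θ) θ = deriv (legendre l) 1 ∧
    (1 / Real.sin θ) * deriv (fun φ₂ => deriv (fun θ₁ => legendreKernel l θ₁ φ θ φ₂) θ) φ = 0 ∧
    (1 / Real.sin θ ^ 2) * deriv (fun φ₂ => deriv (fun φ₁ => legendreKernel l θ φ₁ θ φ₂) φ) φ =
      deriv (legendre l) 1 := by
  have hs : Real.sin θ ≠ 0 := (Real.sin_pos_of_mem_Ioo hθ).ne'
  have hF := contDiff_legendre l
  have hone : Real.cos θ * Real.cos θ + Real.sin θ * Real.sin θ * Real.cos (φ - φ) = 1 := by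
    rw [sub_self, Real.cos_zero]
    linear_combination Real.sin_sq_add_cos_sq θ
  have hcos : HasDerivAt (fun φ₂ => Real.cos (φ - φ₂)) 0 φ := by
    simpa using ((hasDerivAt_id φ).const_sub φ).cos
  have hsin : HasDerivAt (fun φ₂ => Real.sin (φ - φ₂)) (-1) φ := by
    simpa using ((hasDerivAt_id φ).const_sub φ).sin
  have hθ₁ (θ₂ φ₂ : ℝ) : HasDerivAt
      (fun θ₁ => Real.cos θ₁ * Real.cos θ₂ + Real.sin θ₁ * Real.sin θ₂ * Real.cos (φ - φ₂))
      (-Real.sin θ * Real.cos θ₂ + Real.cos θ * Real.sin θ₂ * Real.cos (φ - φ₂)) θ :=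
    ((Real.hasDerivAt_cos θ).mul_const _).add
      (((Real.hasDerivAt_sin θ).mul_const _).mul_const _)
  have hθ₂ (a b : ℝ) := ((Real.hasDerivAt_cos θ).const_mul a).add
    (((Real.hasDerivAt_sin θ).const_mul b).mul_const (Real.cos (φ - φ)))
  have hφ₁ (φ₂ : ℝ) : HasDerivAt
      (fun φ₁ => Real.cos θ * Real.cos θ + Real.sin θ * Real.sin θ * Real.cos (φ₁ - φ₂))
      (-(Real.sin θ * Real.sin θ) * Real.sin (φ - φ₂)) φ := by
    simpa using ((((hasDerivAt_id φ).sub_const φ₂).cos).const_mul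
      (Real.sin θ * Real.sin θ)).const_add (Real.cos θ * Real.cos θ)
  have hφ₂ (a b : ℝ) := (hcos.const_mul b).const_add a
  unfold legendreKernel
  refine ⟨?_, ?_, ?_⟩
  · rw [deriv_deriv_comp_of_eq_zero hF (fun θ₂ => hθ₁ θ₂ φ) (hθ₂ _ _) (hθ₂ _ _)
      (by rw [sub_self, Real.cos_zero]; ring), hone, sub_self, Real.cos_zero]
    linear_combination deriv (legendre l) 1 * Real.sin_sq_add_cos_sq θ
  · rw [deriv_deriv_comp_of_eq_zero hF (fun φ₂ => hθ₁ θ φ₂) (hφ₂ _ _) (hφ₂ _ _)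
      (by rw [sub_self, Real.cos_zero]; ring)]
    ring
  · rw [deriv_deriv_comp_of_eq_zero hF hφ₁ (hφ₂ _ _) (hsin.const_mul _) (by simp), hone]
    field_simp
end

section
/- Let ℓ ∈ ℕ and let K be the Legendre covariance kernel of degree ℓ. Then for every θ ∈ (0, π) and every φ ∈ ℝ, evaluating at the diagonal point θ₁ = θ₂ = θ, φ₁ = φ₂ = φ one has: (i) ∂³K/∂θ₁²∂θ₂ = 0; (ii) (1/sin θ) · ∂³K/∂θ₁²∂φ₂ = 0. -/
open Real MeasureTheory

/-- A function symmetric about `a` has vanishing derivative at `a`. -/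
theorem deriv_eq_zero_of_symmetric (f : ℝ → ℝ) (a : ℝ) (h : ∀ x, f (2 * a - x) = f x) :
    deriv f a = 0 := by
  have key := deriv_comp_const_sub f (2 * a) a
  rw [funext h, show 2 * a - a = a by ring] at key
  linarith

/-- On a common meridian the kernel depends only on the difference of the colatitudes. -/
theorem legendreKernel_same_longitude (l : ℕ) (θ₁ θ₂ φ : ℝ) :
    legendreKernel l θ₁ φ θ₂ φ = legendre l (Real.cos (θ₁ - θ₂)) := by
  simp [legendreKernel, Real.cos_sub]

theorem legendreKernel_reflect_longitude (l : ℕ) (θ₁ θ₂ φ₁ φ₂ : ℝ) :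
    legendreKernel l θ₁ φ₁ θ₂ (2 * φ₁ - φ₂) = legendreKernel l θ₁ φ₁ θ₂ φ₂ := by
  unfold legendreKernel
  rw [← Real.cos_neg (φ₁ - φ₂), show φ₁ - (2 * φ₁ - φ₂) = -(φ₁ - φ₂) by ring]

theorem stmt1 (l : ℕ) (θ φ : ℝ) (hθ : θ ∈ Set.Ioo 0 Real.pi) :
    deriv (fun θ₂ => iteratedDeriv 2 (fun θ₁ => legendreKernel l θ₁ φ θ₂ φ) θ) θ = 0 ∧
    (1 / Real.sin θ) *
      deriv (fun φ₂ => iteratedDeriv 2 (fun θ₁ => legendreKernel l θ₁ φ θ φ₂) θ) φ = 0 := by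
  constructor
  · apply deriv_eq_zero_of_symmetric
    intro x
    have shift (y : ℝ) : iteratedDeriv 2 (fun θ₁ => legendreKernel l θ₁ φ y φ) θ =
        iteratedDeriv 2 (fun t => legendre l (Real.cos t)) (θ - y) := by
      simp only [legendreKernel_same_longitude]
      exact congrFun (iteratedDeriv_comp_sub_const 2 (fun t => legendre l (Real.cos t)) y) θ
    have even := iteratedDeriv_comp_neg 2 (fun t => legendre l (Real.cos t)) (θ - x)
    simp only [Real.cos_neg, even_two, Even.neg_pow, one_pow, one_smul] at even
    rw [shift, shift, even, show θ - (2 * θ - x) = -(θ - x) by ring]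
  · rw [deriv_eq_zero_of_symmetric, mul_zero]
    intro x
    simp only [legendreKernel_reflect_longitude]
end

section
/- Let ℓ ∈ ℕ and let K be the Legendre covariance kernel of degree ℓ. Then for every θ ∈ (0, π) and every φ ∈ ℝ, evaluating at the diagonal point θ₁ = θ₂ = θ, φ₁ = φ₂ = φ one has (1/sin²θ) · ∂⁴K/∂φ₁²∂θ₂² = P_ℓ''(1) + P_ℓ'(1). -/
open Real MeasureTheory

/-- The Legendre function given by Rodrigues' formula is a polynomial function. -/
theorem exists_polynomial_legendre (l : ℕ) :
    ∃ p : Polynomial ℝ, legendre l = fun t => p.eval t := by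
  have iteratedDeriv_eval (n : ℕ) (q : Polynomial ℝ) :
      iteratedDeriv n (fun t => q.eval t) = fun t => (Polynomial.derivative^[n] q).eval t := by
    induction n generalizing q with
    | zero => simp
    | succ n ih =>
      rw [iteratedDeriv_succ', Function.iterate_succ_apply, ← ih]
      congr 1
      ext t
      exact q.deriv
  refine ⟨Polynomial.C (1 / (2 ^ l * (Nat.factorial l : ℝ))) *
    Polynomial.derivative^[l] ((Polynomial.X ^ 2 - 1) ^ l), ?_⟩
  ext t
  have h := congrFun (iteratedDeriv_eval l ((Polynomial.X ^ 2 - 1) ^ l)) t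
  simp only [Polynomial.eval_pow, Polynomial.eval_sub, Polynomial.eval_X,
    Polynomial.eval_one] at h
  rw [legendre, h, Polynomial.eval_mul, Polynomial.eval_C]

/-- A second derivative computed from two successive first derivatives. -/
theorem iteratedDeriv_two_eq_of_hasDerivAt {f f' : ℝ → ℝ} {c x : ℝ}
    (hf : ∀ y, HasDerivAt f (f' y) y) (hf' : HasDerivAt f' c x) :
    iteratedDeriv 2 f x = c := by
  rw [iteratedDeriv_succ, iteratedDeriv_one, show deriv f = f' from funext fun y => (hf y).deriv]
  exact hf'.deriv

/-- The second derivative at `φ` of a polynomial in `a + b * cos (x - φ)`. -/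
theorem iteratedDeriv_two_eval_add_mul_cos (p : Polynomial ℝ) (a b φ : ℝ) :
    iteratedDeriv 2 (fun x => p.eval (a + b * cos (x - φ))) φ =
      -(b * p.derivative.eval (a + b)) := by
  have hg (y : ℝ) : HasDerivAt (fun x => a + b * cos (x - φ)) (b * -sin (y - φ)) y := by
    simpa using (((hasDerivAt_id y).sub_const φ).cos.const_mul b).const_add a
  have hs : HasDerivAt (fun x => b * -sin (x - φ)) (-b) φ := by
    simpa using ((hasDerivAt_id φ).sub_const φ).sin.neg.const_mul b
  refine iteratedDeriv_two_eq_of_hasDerivAt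
    (fun y => (p.hasDerivAt _).comp y (hg y)) ?_
  refine (((p.derivative.hasDerivAt _).comp φ (hg φ)).mul hs).congr_deriv ?_
  simp [mul_comm]

/-- The second derivative at `θ` of `c * sin x` times a polynomial in `cos (θ - x)`. -/
theorem iteratedDeriv_two_sin_mul_eval_cos (q : Polynomial ℝ) (c θ : ℝ) :
    iteratedDeriv 2 (fun x => c * sin x * q.eval (cos (θ - x))) θ =
      -(c * sin θ * (q.derivative.eval 1 + q.eval 1)) := by
  have hu (y : ℝ) : HasDerivAt (fun x => cos (θ - x)) (sin (θ - y)) y := by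
    simpa using ((hasDerivAt_id y).const_sub θ).cos
  have hv : HasDerivAt (fun x => sin (θ - x)) (-1) θ := by
    simpa using ((hasDerivAt_id θ).const_sub θ).sin
  have hq (r : Polynomial ℝ) (y : ℝ) := (r.hasDerivAt (cos (θ - y))).comp y (hu y)
  have hs (y : ℝ) := (hasDerivAt_sin y).const_mul c
  have hc (y : ℝ) := (hasDerivAt_cos y).const_mul c
  refine iteratedDeriv_two_eq_of_hasDerivAt (fun y => (hs y).mul (hq q y)) ?_
  refine (((hc θ).mul (hq q θ)).add
    ((hs θ).mul ((hq q.derivative θ).mul hv))).congr_deriv ?_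
  simp
  ring

theorem stmt5 (l : ℕ) (θ φ : ℝ) (hθ : θ ∈ Set.Ioo 0 Real.pi) :
    (1 / Real.sin θ ^ 2) *
      iteratedDeriv 2 (fun θ₂ => iteratedDeriv 2 (fun φ₁ => legendreKernel l θ φ₁ θ₂ φ) φ) θ =
      iteratedDeriv 2 (legendre l) 1 + deriv (legendre l) 1 := by
  obtain ⟨p, hp⟩ := exists_polynomial_legendre l
  have hsin : sin θ ≠ 0 := (sin_pos_of_mem_Ioo hθ).ne'
  have hinner : (fun θ₂ => iteratedDeriv 2 (fun φ₁ => legendreKernel l θ φ₁ θ₂ φ) φ) =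
      fun θ₂ => -sin θ * sin θ₂ * p.derivative.eval (cos (θ - θ₂)) := by
    ext θ₂
    simp only [legendreKernel, hp]
    rw [iteratedDeriv_two_eval_add_mul_cos, cos_sub]
    ring
  rw [hinner, iteratedDeriv_two_sin_mul_eval_cos, hp, Polynomial.deriv,
    iteratedDeriv_two_eq_of_hasDerivAt p.hasDerivAt (p.derivative.hasDerivAt 1)]
  field_simp
end

section
/- Let ℓ ∈ ℕ and let K be the Legendre covariance kernel of degree ℓ. Then for every θ ∈ (0, π) and every φ ∈ ℝ, evaluating at the diagonal point θ₁ = θ₂ = θ, φ₁ = φ₂ = φ one has (1/sin θ) · ∂⁴K/∂θ₁²∂φ₂∂θ₂ = 0. -/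
open Real MeasureTheory

theorem deriv_eq_zero_of_reflection {g : ℝ → ℝ} {a : ℝ} (hg : ∀ x, g (2 * a - x) = g x) :
    deriv g a = 0 := by
  have h := deriv_comp_const_sub g (2 * a) a
  rw [funext hg, show 2 * a - a = a by ring] at h
  linarith

theorem legendreKernel_reflection (l : ℕ) (θ₁ φ θ₂ x : ℝ) :
    legendreKernel l θ₁ φ θ₂ (2 * φ - x) = legendreKernel l θ₁ φ θ₂ x := by
  unfold legendreKernel
  rw [← Real.cos_neg (φ - x), show -(φ - x) = φ - (2 * φ - x) by ring]

theorem stmt8 (l : ℕ) (θ φ : ℝ) (hθ : θ ∈ Set.Ioo 0 Real.pi) :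
    (1 / Real.sin θ) *
      deriv (fun θ₂ =>
        deriv (fun φ₂ => iteratedDeriv 2 (fun θ₁ => legendreKernel l θ₁ φ θ₂ φ₂) θ) φ) θ
      = 0 := by
  have h (θ₂ : ℝ) :
      deriv (fun φ₂ => iteratedDeriv 2 (fun θ₁ => legendreKernel l θ₁ φ θ₂ φ₂) θ) φ = 0 :=
    deriv_eq_zero_of_reflection fun x => by simp only [legendreKernel_reflection]
  simp [h]
end

section
/- Let γ be the centered Gaussian measure on ℝ³ with covariance matrix Σ having rows (3, 0, 1), (0, 1, 0), (1, 0, 3), i.e. the measure with density γ(z₁, z₂, z₃) = (2π)^{−3/2} · 8^{−1/2} · exp(−(3z₁² − 2z₁z₃ + 3z₃²)/16 − z₂²/2) with respect to Lebesgue measure on ℝ³ (note det Σ = 8). Define p₀ᶜ(t) = √(2/π) · (2e^{−t²} + t² − 1) · e^{−t²/2}. Then for every interval I ⊆ ℝ, ∫_{ℝ³} |z₁z₃ − z₂²| · 1_{{(z₁+z₃)/√8 ∈ I}} dγ = ∫_I p₀ᶜ(t) dt. -/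
open Real MeasureTheory

/-- Density of the centered Gaussian measure on `ℝ³` with covariance matrix
`[(3,0,1);(0,1,0);(1,0,3)]` (whose determinant is `8`). -/
noncomputable def gaussDens (z : ℝ × ℝ × ℝ) : ℝ :=
  (2 * Real.pi) ^ (-(3 : ℝ) / 2) * (8 : ℝ) ^ (-(1 : ℝ) / 2) *
    Real.exp (-(3 * z.1 ^ 2 - 2 * z.1 * z.2.2 + 3 * z.2.2 ^ 2) / 16 - z.2.1 ^ 2 / 2)

noncomputable def p0c (t : ℝ) : ℝ :=
  Real.sqrt (2 / Real.pi) * (2 * Real.exp (-t ^ 2) + t ^ 2 - 1) * Real.exp (-t ^ 2 / 2)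

/-- The radial integral `∫₀^∞ r |s² - r²| e^{-r²/2} dr`. -/
theorem integral_Ioi_mul_abs_sub_sq_mul_exp {s : ℝ} (hs : 0 ≤ s) :
    ∫ r in Set.Ioi (0 : ℝ), r * (|s ^ 2 - r ^ 2| * exp (-r ^ 2 / 2)) =
      4 * exp (-s ^ 2 / 2) + s ^ 2 - 2 := by
  set F : ℝ → ℝ := fun r => -((r ^ 2 + 2 - s ^ 2) * exp (-r ^ 2 / 2)) with hF
  have hd : ∀ r, HasDerivAt F (r * ((r ^ 2 - s ^ 2) * exp (-r ^ 2 / 2))) r := by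
    intro r
    have h1 : HasDerivAt (fun r : ℝ => r ^ 2) (2 * r) r := by
      simpa using hasDerivAt_pow 2 r
    have h2 : HasDerivAt (fun r : ℝ => exp (-r ^ 2 / 2)) (exp (-r ^ 2 / 2) * (-(2 * r) / 2)) r :=
      (h1.neg.div_const 2).exp
    exact (((h1.add_const 2).sub_const (s ^ 2)).mul h2).neg.congr_deriv (by ring)
  have hlim : Filter.Tendsto F Filter.atTop (nhds 0) := by
    have hsq : Filter.Tendsto (fun r : ℝ => r ^ 2 / 2) Filter.atTop Filter.atTop :=
      (Filter.tendsto_pow_atTop two_ne_zero).atTop_div_const two_pos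
    have h0 := (tendsto_pow_mul_exp_neg_atTop_nhds_zero 0).comp hsq
    have h1 := (tendsto_pow_mul_exp_neg_atTop_nhds_zero 1).comp hsq
    have h := (h1.const_mul (-2)).add (h0.const_mul (s ^ 2 - 2))
    simp only [mul_zero, add_zero] at h
    refine h.congr fun r => ?_
    simp only [hF, Function.comp_apply, neg_div]
    ring
  have hpos : ∀ r ∈ Set.Ioi s, 0 ≤ r * ((r ^ 2 - s ^ 2) * exp (-r ^ 2 / 2)) := by
    intro r hr
    have hr' : s < r := hr
    have h2 : 0 ≤ r ^ 2 - s ^ 2 := by nlinarith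
    have h3 : 0 ≤ r := by linarith
    positivity
  have hcont : Continuous fun r : ℝ => r * (|s ^ 2 - r ^ 2| * exp (-r ^ 2 / 2)) := by fun_prop
  have htail : Set.EqOn (fun r : ℝ => r * ((r ^ 2 - s ^ 2) * exp (-r ^ 2 / 2)))
      (fun r => r * (|s ^ 2 - r ^ 2| * exp (-r ^ 2 / 2))) (Set.Ioi s) := by
    intro r hr
    have hr' : s < r := hr
    simp only
    rw [abs_of_nonpos (by nlinarith), neg_sub]
  have htail_int : IntegrableOn (fun r : ℝ => r * (|s ^ 2 - r ^ 2| * exp (-r ^ 2 / 2))) (Set.Ioi s) :=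
    (integrableOn_Ioi_deriv_of_nonneg' (fun r _ => hd r) hpos hlim).congr_fun htail
      measurableSet_Ioi
  have hI2 : ∫ r in Set.Ioi s, r * (|s ^ 2 - r ^ 2| * exp (-r ^ 2 / 2)) = 0 - F s := by
    rw [← setIntegral_congr_fun measurableSet_Ioi htail]
    exact integral_Ioi_of_hasDerivAt_of_nonneg' (fun r _ => hd r) hpos hlim
  have hI1 : ∫ r in (0 : ℝ)..s, r * (|s ^ 2 - r ^ 2| * exp (-r ^ 2 / 2)) = -(F s - F 0) := by
    rw [← intervalIntegral.integral_eq_sub_of_hasDerivAt (fun r _ => hd r)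
      (Continuous.intervalIntegrable (by fun_prop) _ _), ← intervalIntegral.integral_neg]
    refine intervalIntegral.integral_congr fun r hr => ?_
    rw [Set.uIcc_of_le hs] at hr
    rw [abs_of_nonneg (by nlinarith [hr.1, hr.2])]
    ring
  rw [← Set.Ioc_union_Ioi_eq_Ioi hs, setIntegral_union (Set.Ioc_disjoint_Ioi le_rfl)
    measurableSet_Ioi ((hcont.intervalIntegrable 0 s).1) htail_int,
    ← intervalIntegral.integral_of_le hs, hI1, hI2]
  simp only [hF]
  norm_num
  ring

theorem integral_abs_sub_normSq_mul_exp {s : ℝ} (hs : 0 ≤ s) :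
    ∫ p : ℝ × ℝ, |s ^ 2 - (p.1 ^ 2 + p.2 ^ 2)| * exp (-(p.1 ^ 2 + p.2 ^ 2) / 2) =
      2 * π * (4 * exp (-s ^ 2 / 2) + s ^ 2 - 2) := by
  rw [← integral_comp_polarCoord_symm, polarCoord_target]
  have h : ∀ p : ℝ × ℝ, p.1 • (|s ^ 2 - ((polarCoord.symm p).1 ^ 2 + (polarCoord.symm p).2 ^ 2)| *
      exp (-((polarCoord.symm p).1 ^ 2 + (polarCoord.symm p).2 ^ 2) / 2)) =
      p.1 * (|s ^ 2 - p.1 ^ 2| * exp (-p.1 ^ 2 / 2)) * 1 := by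
    intro p
    have : (p.1 * cos p.2) ^ 2 + (p.1 * sin p.2) ^ 2 = p.1 ^ 2 := by
      rw [mul_pow, mul_pow, ← mul_add, cos_sq_add_sin_sq, mul_one]
    simp only [polarCoord_symm_apply, this, smul_eq_mul, mul_one]
  simp only [h]
  rw [Measure.volume_eq_prod, setIntegral_prod_mul
    (fun r : ℝ => r * (|s ^ 2 - r ^ 2| * exp (-r ^ 2 / 2))) (fun _ : ℝ => (1 : ℝ)),
    integral_Ioi_mul_abs_sub_sq_mul_exp hs]
  have : (0 : ℝ) ≤ π + π := by positivity
  simp [this]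
  ring

/-- The linear map `(t, c, b) ↦ (√2 t + b, c, √2 t - b)` diagonalizing the quadratic form
in `gaussDens`. -/
noncomputable def diagMap : ℝ × ℝ × ℝ →ₗ[ℝ] ℝ × ℝ × ℝ where
  toFun w := (√2 * w.1 + w.2.2, w.2.1, √2 * w.1 - w.2.2)
  map_add' v w := by ext <;> simp <;> ring
  map_smul' r w := by ext <;> simp <;> ring

theorem diagMap_apply (w : ℝ × ℝ × ℝ) :
    diagMap w = (√2 * w.1 + w.2.2, w.2.1, √2 * w.1 - w.2.2) := rfl

/-- The standard coordinates on `ℝ × ℝ × ℝ`. -/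
def coordEquiv : (ℝ × ℝ × ℝ) ≃ₗ[ℝ] (Fin 3 → ℝ) where
  toFun w := ![w.1, w.2.1, w.2.2]
  invFun v := (v 0, v 1, v 2)
  map_add' v w := by ext i; fin_cases i <;> rfl
  map_smul' r w := by ext i; fin_cases i <;> rfl
  left_inv w := rfl
  right_inv v := by ext i; fin_cases i <;> rfl

theorem coordEquiv_apply (w : ℝ × ℝ × ℝ) : coordEquiv w = ![w.1, w.2.1, w.2.2] := rfl

theorem coordEquiv_symm_apply (v : Fin 3 → ℝ) : coordEquiv.symm v = (v 0, v 1, v 2) := rfl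

theorem det_diagMap : LinearMap.det diagMap = -(2 * √2) := by
  have h : LinearMap.toMatrix (Module.Basis.ofEquivFun coordEquiv)
      (Module.Basis.ofEquivFun coordEquiv) diagMap = !![√2, 0, 1; 0, 1, 0; √2, 0, -1] := by
    ext i j
    fin_cases i <;> fin_cases j <;>
      simp [LinearMap.toMatrix_apply, coordEquiv_apply, coordEquiv_symm_apply, diagMap_apply]
  rw [← LinearMap.det_toMatrix (Module.Basis.ofEquivFun coordEquiv), h, Matrix.det_fin_three]
  simp
  ring

theorem integral_comp_diagMap {f : ℝ × ℝ × ℝ → ℝ} (hf : Measurable f) :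
    ∫ z, f z = 2 * √2 * ∫ w, f (diagMap w) := by
  have hdet : LinearMap.det diagMap ≠ 0 := by rw [det_diagMap]; simp
  have : (volume : Measure (ℝ × ℝ)).IsAddHaarMeasure :=
    inferInstanceAs ((volume : Measure ℝ).prod (volume : Measure ℝ)).IsAddHaarMeasure
  have : (volume : Measure (ℝ × ℝ × ℝ)).IsAddHaarMeasure :=
    inferInstanceAs ((volume : Measure ℝ).prod (volume : Measure (ℝ × ℝ))).IsAddHaarMeasure
  have hm : Measurable diagMap := (LinearMap.continuous_of_finiteDimensional diagMap).measurable
  rw [← integral_map hm.aemeasurable hf.aestronglyMeasurable,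
    Measure.map_linearMap_addHaar_eq_smul_addHaar volume hdet, integral_smul_measure, det_diagMap,
    ENNReal.toReal_ofReal (abs_nonneg _), smul_eq_mul, abs_inv, abs_neg,
    abs_of_pos (by positivity), mul_inv_cancel_left₀ (by positivity)]

theorem integrable_pow_mul_exp_neg_sq_div_two (n : ℕ) :
    Integrable fun x : ℝ => x ^ n * exp (-x ^ 2 / 2) := by
  have h := integrable_rpow_mul_exp_neg_mul_sq (b := 1 / 2) (by norm_num) (s := n)
    (by have : (0 : ℝ) ≤ n := n.cast_nonneg
        linarith)
  refine h.congr (.of_forall fun x => ?_)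
  simp only [rpow_natCast]
  congr 2
  ring

theorem integrable_abs_mul_exp_neg_normSq :
    Integrable fun w : ℝ × ℝ × ℝ => |2 * w.1 ^ 2 - (w.2.1 ^ 2 + w.2.2 ^ 2)| *
      exp (-(w.1 ^ 2 + (w.2.1 ^ 2 + w.2.2 ^ 2)) / 2) := by
  have g := integrable_pow_mul_exp_neg_sq_div_two
  have h1 := ((g 2).mul_prod ((g 0).mul_prod (g 0))).const_mul 2
  have h2 := (g 0).mul_prod ((g 2).mul_prod (g 0))
  have h3 := (g 0).mul_prod ((g 0).mul_prod (g 2))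
  refine (h1.sub (h2.add h3)).abs.congr (.of_forall fun w => ?_)
  have he : exp (-(w.1 ^ 2 + (w.2.1 ^ 2 + w.2.2 ^ 2)) / 2) =
      exp (-w.1 ^ 2 / 2) * (exp (-w.2.1 ^ 2 / 2) * exp (-w.2.2 ^ 2 / 2)) := by
    rw [← exp_add, ← exp_add]; congr 1; ring
  simp only [Pi.sub_apply, Pi.add_apply]
  rw [he, ← abs_of_pos (a := exp (-w.1 ^ 2 / 2) * _) (by positivity), ← abs_mul]
  congr 1
  ring

theorem stmt18 (I : Set ℝ) (hI : I.OrdConnected) :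
    (∫ z : ℝ × ℝ × ℝ, |z.1 * z.2.2 - z.2.1 ^ 2| *
        Set.indicator I (fun _ => (1 : ℝ)) ((z.1 + z.2.2) / Real.sqrt 8) * gaussDens z) =
      ∫ t in I, p0c t := by
  have hIm : MeasurableSet I := hI.measurableSet
  have hind : Measurable (Set.indicator I fun _ => (1 : ℝ)) := measurable_const.indicator hIm
  have h2 : √2 ^ 2 = (2 : ℝ) := sq_sqrt zero_le_two
  have h8 : √8 = 2 * √2 := by
    rw [show (8 : ℝ) = 2 ^ 2 * 2 by norm_num, sqrt_mul (by norm_num), sqrt_sq zero_le_two]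
  have hmeas : Measurable fun z : ℝ × ℝ × ℝ => |z.1 * z.2.2 - z.2.1 ^ 2| *
      Set.indicator I (fun _ => (1 : ℝ)) ((z.1 + z.2.2) / √8) * gaussDens z := by
    have hi : Measurable fun z : ℝ × ℝ × ℝ =>
        Set.indicator I (fun _ => (1 : ℝ)) ((z.1 + z.2.2) / √8) := hind.comp (by fun_prop)
    have hg : Measurable gaussDens := by unfold gaussDens; fun_prop
    have ha : Measurable fun z : ℝ × ℝ × ℝ => |z.1 * z.2.2 - z.2.1 ^ 2| :=
      Continuous.measurable (by fun_prop)
    exact (ha.mul hi).mul hg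
  set C : ℝ := (2 * π) ^ (-(3 : ℝ) / 2) * (8 : ℝ) ^ (-(1 : ℝ) / 2) with hC
  have hC' : 2 * √2 * C * (2 * π) * 2 = √(2 / π) := by
    have e8 : (8 : ℝ) ^ (-(1 : ℝ) / 2) = (2 * √2)⁻¹ := by
      rw [neg_div, rpow_neg (by norm_num), ← sqrt_eq_rpow, h8]
    have eπ : (2 * π) ^ (-(3 : ℝ) / 2) = (2 * π)⁻¹ * (√(2 * π))⁻¹ := by
      rw [show -(3 : ℝ) / 2 = -1 + -(1 / 2) by norm_num, rpow_add (by positivity),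
        rpow_neg_one, rpow_neg (by positivity), ← sqrt_eq_rpow]
    have hs : √(2 / π) * √(2 * π) = 2 := by
      rw [← sqrt_mul (by positivity), show 2 / π * (2 * π) = 2 ^ 2 by field_simp,
        sqrt_sq zero_le_two]
    rw [hC, e8, eπ]
    field_simp
    linarith
  have hcomp : ∀ w : ℝ × ℝ × ℝ, |(diagMap w).1 * (diagMap w).2.2 - (diagMap w).2.1 ^ 2| *
      Set.indicator I (fun _ => (1 : ℝ)) (((diagMap w).1 + (diagMap w).2.2) / √8) *
        gaussDens (diagMap w) =
      C * Set.indicator (Prod.fst ⁻¹' I) (fun w : ℝ × ℝ × ℝ =>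
        |2 * w.1 ^ 2 - (w.2.1 ^ 2 + w.2.2 ^ 2)| *
          exp (-(w.1 ^ 2 + (w.2.1 ^ 2 + w.2.2 ^ 2)) / 2)) w := by
    intro w
    have e1 : (√2 * w.1 + w.2.2) * (√2 * w.1 - w.2.2) - w.2.1 ^ 2 =
        2 * w.1 ^ 2 - (w.2.1 ^ 2 + w.2.2 ^ 2) := by linear_combination w.1 ^ 2 * h2
    have e2 : (√2 * w.1 + w.2.2 + (√2 * w.1 - w.2.2)) / √8 = w.1 := by
      rw [h8]; field_simp; ring
    have e3 : -(3 * (√2 * w.1 + w.2.2) ^ 2 - 2 * (√2 * w.1 + w.2.2) * (√2 * w.1 - w.2.2) +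
        3 * (√2 * w.1 - w.2.2) ^ 2) / 16 - w.2.1 ^ 2 / 2 =
        -(w.1 ^ 2 + (w.2.1 ^ 2 + w.2.2 ^ 2)) / 2 := by
      linear_combination (-w.1 ^ 2 / 4) * h2
    simp only [diagMap_apply, gaussDens, e1, e2, e3, ← hC]
    by_cases hw : w.1 ∈ I
    · rw [Set.indicator_of_mem hw, Set.indicator_of_mem (show w ∈ Prod.fst ⁻¹' I from hw)]
      ring
    · rw [Set.indicator_of_notMem hw, Set.indicator_of_notMem (show w ∉ Prod.fst ⁻¹' I from hw)]
      ring
  rw [integral_comp_diagMap hmeas]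
  simp only [hcomp]
  rw [integral_const_mul, Measure.volume_eq_prod, integral_prod _
    (integrable_abs_mul_exp_neg_normSq.indicator (measurable_fst hIm)), ← integral_const_mul,
    ← integral_const_mul, ← integral_indicator hIm]
  refine integral_congr_ae (.of_forall fun t => ?_)
  simp only
  by_cases ht : t ∈ I
  · have hin : ∀ y : ℝ × ℝ, Set.indicator (Prod.fst ⁻¹' I) (fun w : ℝ × ℝ × ℝ =>
        |2 * w.1 ^ 2 - (w.2.1 ^ 2 + w.2.2 ^ 2)| *
          exp (-(w.1 ^ 2 + (w.2.1 ^ 2 + w.2.2 ^ 2)) / 2)) (t, y) =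
        exp (-t ^ 2 / 2) * (|(√2 * |t|) ^ 2 - (y.1 ^ 2 + y.2 ^ 2)| *
          exp (-(y.1 ^ 2 + y.2 ^ 2) / 2)) := by
      intro y
      rw [Set.indicator_of_mem (show (t, y) ∈ Prod.fst ⁻¹' I from ht), mul_pow, h2, sq_abs,
        mul_left_comm, ← exp_add]
      congr 2
      ring
    simp only [hin]
    rw [integral_const_mul, integral_abs_sub_normSq_mul_exp (by positivity),
      Set.indicator_of_mem ht, mul_pow, h2, sq_abs, p0c, ← hC']
    rw [show -(2 * t ^ 2) / 2 = -t ^ 2 by ring]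
    ring
  · simp [ht]
end

section
/- Let γ be the centered Gaussian measure on ℝ³ with covariance matrix Σ having rows (3, 0, 1), (0, 1, 0), (1, 0, 3), i.e. the measure with density γ(z₁, z₂, z₃) = (2π)^{−3/2} · 8^{−1/2} · exp(−(3z₁² − 2z₁z₃ + 3z₃²)/16 − z₂²/2) with respect to Lebesgue measure on ℝ³ (note det Σ = 8). Define p₂ᶜ(t) = √(2/π) · (−4 + t² + t⁴ + 2e^{−t²}(4 + 3t²)) · e^{−t²/2}. Then for every interval I ⊆ ℝ, ∫_{ℝ³} |z₁z₃ − z₂²| · (z₁ − 3z₃)² · 1_{{(z₁+z₃)/√8 ∈ I}} dγ = 8 ∫_I p₂ᶜ(t) dt. -/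
open Real MeasureTheory

noncomputable def p2c (t : ℝ) : ℝ :=
  Real.sqrt (2 / Real.pi) * (-4 + t ^ 2 + t ^ 4 + 2 * Real.exp (-t ^ 2) * (4 + 3 * t ^ 2)) *
    Real.exp (-t ^ 2 / 2)

open Set Filter Topology

/-- Linear change of variables in a Lebesgue integral over a finite-dimensional space. -/
theorem integral_eq_abs_det_mul_integral_comp {E : Type*} [NormedAddCommGroup E] [NormedSpace ℝ E]
    [FiniteDimensional ℝ E] [MeasurableSpace E] [BorelSpace E] (μ : Measure E)
    [Measure.IsAddHaarMeasure μ] (L : E →ₗ[ℝ] E) (hL : LinearMap.det L ≠ 0) (f : E → ℝ) :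
    ∫ z, f z ∂μ = |LinearMap.det L| * ∫ x, f (L x) ∂μ := by
  have hinj : Function.Injective L := (LinearMap.equivOfDetNeZero L hL).injective
  have hemb : MeasurableEmbedding L :=
    (LinearMap.continuous_of_finiteDimensional L).measurableEmbedding hinj
  rw [← hemb.integral_map, Measure.map_linearMap_addHaar_eq_smul_addHaar μ hL, integral_smul_measure,
    ENNReal.toReal_ofReal (abs_nonneg _), smul_eq_mul, ← mul_assoc, abs_inv,
    mul_inv_cancel₀ (abs_ne_zero.mpr hL), one_mul]

/-- The change of variables `z₁ = √2 t + u`, `z₂ = v`, `z₃ = √2 t - u`. -/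
noncomputable def sumDiffMap : ℝ × ℝ × ℝ →ₗ[ℝ] ℝ × ℝ × ℝ where
  toFun x := (√2 * x.1 + x.2.1, x.2.2, √2 * x.1 - x.2.1)
  map_add' x y := by ext <;> simp <;> ring
  map_smul' c x := by ext <;> simp <;> ring

/-- The coordinates of `ℝ × ℝ × ℝ`. -/
def tripleEquivFun : (ℝ × ℝ × ℝ) ≃ₗ[ℝ] (Fin 3 → ℝ) where
  toFun x := ![x.1, x.2.1, x.2.2]
  invFun y := (y 0, y 1, y 2)
  map_add' x y := by ext i; fin_cases i <;> rfl
  map_smul' c x := by ext i; fin_cases i <;> rfl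
  left_inv x := rfl
  right_inv y := by ext i; fin_cases i <;> rfl

theorem sumDiffMap_apply (x : ℝ × ℝ × ℝ) :
    sumDiffMap x = (√2 * x.1 + x.2.1, x.2.2, √2 * x.1 - x.2.1) := rfl

theorem tripleEquivFun_apply (x : ℝ × ℝ × ℝ) : tripleEquivFun x = ![x.1, x.2.1, x.2.2] := rfl

theorem tripleEquivFun_symm_apply (y : Fin 3 → ℝ) : tripleEquivFun.symm y = (y 0, y 1, y 2) := rfl

theorem det_sumDiffMap : LinearMap.det sumDiffMap = 2 * √2 := by
  rw [← LinearMap.det_toMatrix (Module.Basis.ofEquivFun tripleEquivFun), Matrix.det_fin_three]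
  simp [LinearMap.toMatrix_apply, tripleEquivFun_apply, tripleEquivFun_symm_apply, sumDiffMap_apply]
  ring

theorem integral_comp_sumDiffMap (f : ℝ × ℝ × ℝ → ℝ) :
    ∫ z, f z = 2 * √2 * ∫ x : ℝ × ℝ × ℝ, f (√2 * x.1 + x.2.1, x.2.2, √2 * x.1 - x.2.1) := by
  have : Measure.IsAddHaarMeasure (volume : Measure (ℝ × ℝ)) :=
    Measure.prod.instIsAddHaarMeasure volume volume
  have : Measure.IsAddHaarMeasure (volume : Measure (ℝ × ℝ × ℝ)) :=
    Measure.prod.instIsAddHaarMeasure volume volume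
  have h := integral_eq_abs_det_mul_integral_comp volume sumDiffMap
    (by rw [det_sumDiffMap]; positivity) f
  rwa [det_sumDiffMap, abs_of_pos (by positivity)] at h

/-! ### The radial integral -/

/-- An antiderivative of `(r² - 2a) (a + r²) r exp (-r² / 2)`. -/
noncomputable def radialPrimitive (a r : ℝ) : ℝ :=
  -(r ^ 4 + (4 - a) * r ^ 2 + (8 - 2 * a - 2 * a ^ 2)) * exp (-r ^ 2 / 2)

theorem hasDerivAt_radialPrimitive (a r : ℝ) :
    HasDerivAt (radialPrimitive a) ((r ^ 2 - 2 * a) * (a + r ^ 2) * r * exp (-r ^ 2 / 2)) r := by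
  have h1 : HasDerivAt (fun r : ℝ => -(r ^ 4 + (4 - a) * r ^ 2 + (8 - 2 * a - 2 * a ^ 2)))
      (-(4 * r ^ 3 + (4 - a) * (2 * r))) r := by
    have := ((((hasDerivAt_pow 4 r).add ((hasDerivAt_pow 2 r).const_mul (4 - a))).add_const
      (8 - 2 * a - 2 * a ^ 2)).neg)
    exact this.congr_deriv (by norm_num)
  have h2 : HasDerivAt (fun r : ℝ => exp (-r ^ 2 / 2)) (exp (-r ^ 2 / 2) * (-r)) r := by
    have := (((hasDerivAt_pow 2 r).neg).div_const 2).exp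
    exact this.congr_deriv (by simp; ring)
  exact (h1.mul h2).congr_deriv (by ring)

theorem tendsto_radialPrimitive (a : ℝ) : Tendsto (radialPrimitive a) atTop (𝓝 0) := by
  have hw : Tendsto (fun r : ℝ => r ^ 2 / 2) atTop atTop :=
    (tendsto_pow_atTop two_ne_zero).atTop_div_const two_pos
  have h (n : ℕ) := (tendsto_pow_mul_exp_neg_atTop_nhds_zero n).comp hw
  have := (((h 2).const_mul (-4)).add ((h 1).const_mul (-2 * (4 - a)))).add
    ((h 0).const_mul (-(8 - 2 * a - 2 * a ^ 2)))
  simp only [mul_zero, add_zero] at this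
  refine this.congr fun r => ?_
  simp only [Function.comp, radialPrimitive, neg_div]
  ring

/-- The radial integrand. -/
noncomputable def radialFun (a r : ℝ) : ℝ :=
  |2 * a - r ^ 2| * (a + r ^ 2) * r * exp (-r ^ 2 / 2)

theorem continuous_radialFun (a : ℝ) : Continuous (radialFun a) := by
  unfold radialFun; fun_prop

theorem radialFun_of_le {a r : ℝ} (h : r ^ 2 ≤ 2 * a) :
    radialFun a r = -((r ^ 2 - 2 * a) * (a + r ^ 2) * r * exp (-r ^ 2 / 2)) := by
  rw [radialFun, abs_of_nonneg (by linarith)]; ring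

theorem radialFun_of_ge {a r : ℝ} (h : 2 * a ≤ r ^ 2) :
    radialFun a r = (r ^ 2 - 2 * a) * (a + r ^ 2) * r * exp (-r ^ 2 / 2) := by
  rw [radialFun, abs_of_nonpos (by linarith)]; ring

theorem radialFun_tail {a : ℝ} (ha : 0 ≤ a) :
    IntegrableOn (radialFun a) (Ioi (√(2 * a))) ∧
      ∫ r in Ioi (√(2 * a)), radialFun a r = -radialPrimitive a (√(2 * a)) := by
  have hge : ∀ r ∈ Ioi (√(2 * a)), 2 * a ≤ r ^ 2 := fun r hr =>
    (Real.sqrt_le_left (le_trans (Real.sqrt_nonneg _) (le_of_lt hr))).mp (le_of_lt hr)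
  have hnn : ∀ r ∈ Ioi (√(2 * a)), 0 ≤ (r ^ 2 - 2 * a) * (a + r ^ 2) * r * exp (-r ^ 2 / 2) := by
    intro r hr
    have h0 : 0 ≤ r := le_trans (Real.sqrt_nonneg _) (le_of_lt hr)
    have h1 : 0 ≤ r ^ 2 - 2 * a := sub_nonneg.mpr (hge r hr)
    positivity
  have hd : ∀ r ∈ Ici (√(2 * a)), HasDerivAt (radialPrimitive a) _ r :=
    fun r _ => hasDerivAt_radialPrimitive a r
  constructor
  · exact (integrableOn_Ioi_deriv_of_nonneg' hd hnn (tendsto_radialPrimitive a)).congr_fun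
      (fun r hr => (radialFun_of_ge (hge r hr)).symm) measurableSet_Ioi
  · rw [setIntegral_congr_fun measurableSet_Ioi fun r hr => radialFun_of_ge (hge r hr),
      integral_Ioi_of_hasDerivAt_of_nonneg' hd hnn (tendsto_radialPrimitive a), zero_sub]

theorem integrableOn_radialFun {a : ℝ} (ha : 0 ≤ a) : IntegrableOn (radialFun a) (Ioi 0) := by
  rw [← Ioc_union_Ioi_eq_Ioi (Real.sqrt_nonneg (2 * a))]
  exact (continuous_radialFun a).integrableOn_Ioc.union (radialFun_tail ha).1

theorem integral_radialFun {a : ℝ} (ha : 0 ≤ a) :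
    ∫ r in Ioi 0, radialFun a r = 2 * (-4 + a + a ^ 2 + 2 * exp (-a) * (4 + 3 * a)) := by
  have hs : √(2 * a) ^ 2 = 2 * a := Real.sq_sqrt (by positivity)
  have hle : ∀ r ∈ uIcc 0 (√(2 * a)), radialFun a r =
      -((r ^ 2 - 2 * a) * (a + r ^ 2) * r * exp (-r ^ 2 / 2)) := by
    intro r hr
    rw [uIcc_of_le (Real.sqrt_nonneg _)] at hr
    exact radialFun_of_le (hs ▸ pow_le_pow_left₀ hr.1 hr.2 2)
  rw [← Ioc_union_Ioi_eq_Ioi (Real.sqrt_nonneg (2 * a)),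
    setIntegral_union (Ioc_disjoint_Ioi le_rfl) measurableSet_Ioi
      (continuous_radialFun a).integrableOn_Ioc (radialFun_tail ha).1, (radialFun_tail ha).2,
    ← intervalIntegral.integral_of_le (Real.sqrt_nonneg _), intervalIntegral.integral_congr hle,
    intervalIntegral.integral_neg, intervalIntegral.integral_eq_sub_of_hasDerivAt
      (fun r _ => hasDerivAt_radialPrimitive a r)
      (Continuous.intervalIntegrable (by fun_prop) _ _)]
  have h4 : √(2 * a) ^ 4 = (2 * a) ^ 2 := by linear_combination (√(2 * a) ^ 2 + 2 * a) * hs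
  simp only [radialPrimitive, h4, hs]
  rw [show -(2 * a) / 2 = -a by ring]
  norm_num
  ring

/-! ### The planar integral -/

theorem integral_angular (t r : ℝ) :
    ∫ θ in Ioo (-π) π, (4 * (r * cos θ) - 2 * √2 * t) ^ 2 = 16 * π * (t ^ 2 + r ^ 2) := by
  have h2 : √2 ^ 2 = 2 := Real.sq_sqrt (by norm_num)
  have e : ∀ θ : ℝ, (4 * (r * cos θ) - 2 * √2 * t) ^ 2 =
      16 * r ^ 2 * cos θ ^ 2 - 16 * √2 * t * r * cos θ + 8 * t ^ 2 := fun θ => by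
    linear_combination 4 * t ^ 2 * h2
  rw [← integral_Ioc_eq_integral_Ioo, ← intervalIntegral.integral_of_le (by linarith [pi_pos])]
  simp_rw [e]
  rw [intervalIntegral.integral_add (Continuous.intervalIntegrable (by fun_prop) _ _)
      (Continuous.intervalIntegrable (by fun_prop) _ _),
    intervalIntegral.integral_sub (Continuous.intervalIntegrable (by fun_prop) _ _)
      (Continuous.intervalIntegrable (by fun_prop) _ _),
    intervalIntegral.integral_const_mul, intervalIntegral.integral_const_mul, integral_cos_sq,
    integral_cos]
  simp
  ring

theorem integral_planar (t : ℝ) :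
    ∫ y : ℝ × ℝ, |2 * t ^ 2 - y.1 ^ 2 - y.2 ^ 2| * (4 * y.1 - 2 * √2 * t) ^ 2 *
      exp (-(y.1 ^ 2 + y.2 ^ 2) / 2) =
    32 * π * (-4 + t ^ 2 + t ^ 4 + 2 * exp (-t ^ 2) * (4 + 3 * t ^ 2)) := by
  have h2 : √2 ^ 2 = 2 := Real.sq_sqrt (by norm_num)
  rw [← integral_comp_polarCoord_symm]
  set G : ℝ × ℝ → ℝ := fun p => (|2 * t ^ 2 - p.1 ^ 2| * p.1 * exp (-p.1 ^ 2 / 2)) *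
    (4 * (p.1 * cos p.2) - 2 * √2 * t) ^ 2 with hG
  have hcongr : ∀ p ∈ polarCoord.target, p.1 • (|2 * t ^ 2 - (polarCoord.symm p).1 ^ 2 -
      (polarCoord.symm p).2 ^ 2| * (4 * (polarCoord.symm p).1 - 2 * √2 * t) ^ 2 *
      exp (-((polarCoord.symm p).1 ^ 2 + (polarCoord.symm p).2 ^ 2) / 2)) = G p := by
    intro p _
    have h : (p.1 * cos p.2) ^ 2 + (p.1 * sin p.2) ^ 2 = p.1 ^ 2 := by
      linear_combination p.1 ^ 2 * sin_sq_add_cos_sq p.2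
    simp only [polarCoord_symm_apply, smul_eq_mul, hG]
    rw [sub_sub, h]
    ring
  have hint : IntegrableOn G (Ioi 0 ×ˢ Ioo (-π) π) := by
    have hb : IntegrableOn (fun p : ℝ × ℝ => (32 * radialFun (t ^ 2) p.1) * 1)
        (Ioi 0 ×ˢ Ioo (-π) π) := by
      rw [IntegrableOn, Measure.volume_eq_prod, ← Measure.prod_restrict]
      exact ((integrableOn_radialFun (sq_nonneg t)).integrable.const_mul 32).mul_prod
        (integrable_const (1 : ℝ))
    refine Integrable.mono' hb (Continuous.aestronglyMeasurable (by fun_prop)) ?_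
    refine (ae_restrict_iff' (measurableSet_Ioi.prod measurableSet_Ioo)).mpr (.of_forall ?_)
    rintro ⟨r, θ⟩ ⟨hr, -⟩
    have hr : 0 < r := hr
    have hsq : (4 * (r * cos θ) - 2 * √2 * t) ^ 2 ≤ 32 * (t ^ 2 + r ^ 2) := by
      nlinarith [sq_nonneg (4 * (r * cos θ) + 2 * √2 * t),
        mul_nonneg (sq_nonneg r) (sub_nonneg.mpr (cos_sq_le_one θ)), sq_nonneg t]
    rw [Real.norm_of_nonneg (by positivity)]
    calc G (r, θ) ≤ (|2 * t ^ 2 - r ^ 2| * r * exp (-r ^ 2 / 2)) * (32 * (t ^ 2 + r ^ 2)) :=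
          mul_le_mul_of_nonneg_left hsq (by positivity)
      _ = _ := by simp only [radialFun]; ring
  rw [setIntegral_congr_fun polarCoord.open_target.measurableSet hcongr, polarCoord_target,
    Measure.volume_eq_prod, setIntegral_prod G hint]
  have hinner : ∀ r : ℝ, ∫ θ in Ioo (-π) π, G (r, θ) = 16 * π * radialFun (t ^ 2) r := by
    intro r
    simp only [hG]
    rw [integral_const_mul, integral_angular]
    simp only [radialFun]
    ring
  simp_rw [hinner]
  rw [integral_const_mul, integral_radialFun (sq_nonneg t)]
  ring

/-! ### Integrability and the main identity -/

theorem sq_mul_exp_neg_half_le {s : ℝ} (hs : 0 ≤ s) :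
    s ^ 2 * exp (-s / 2) ≤ 32 * exp (-s / 4) := by
  have h : s ^ 2 ≤ 32 * exp (s / 4) := by
    linarith [quadratic_le_exp_of_nonneg (by positivity : 0 ≤ s / 4)]
  calc s ^ 2 * exp (-s / 2) ≤ 32 * exp (s / 4) * exp (-s / 2) := by gcongr
    _ = 32 * exp (-s / 4) := by rw [mul_assoc, ← exp_add]; ring_nf

theorem integrable_sumDiff {I : Set ℝ} (hI : MeasurableSet I) :
    Integrable fun x : ℝ × ℝ × ℝ => (I.indicator (fun _ => (1 : ℝ)) x.1 * exp (-x.1 ^ 2 / 2)) *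
      (|2 * x.1 ^ 2 - x.2.1 ^ 2 - x.2.2 ^ 2| * (4 * x.2.1 - 2 * √2 * x.1) ^ 2 *
        exp (-(x.2.1 ^ 2 + x.2.2 ^ 2) / 2)) := by
  have h2 : √2 ^ 2 = 2 := Real.sq_sqrt (by norm_num)
  have hg : Integrable fun t : ℝ => exp (-(1 / 4) * t ^ 2) := integrable_exp_neg_mul_sq (by norm_num)
  have hb := (hg.mul_prod (hg.mul_prod hg)).const_mul 2048
  refine Integrable.mono' hb ?_ (.of_forall ?_)
  · have hm : Measurable (I.indicator fun _ => (1 : ℝ)) := measurable_const.indicator hI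
    exact Measurable.aestronglyMeasurable (by fun_prop)
  · rintro ⟨t, u, v⟩
    have hind0 : 0 ≤ I.indicator (fun _ => (1 : ℝ)) t := indicator_nonneg (by simp) t
    have hind1 : I.indicator (fun _ => (1 : ℝ)) t ≤ 1 := by
      by_cases h : t ∈ I <;> simp [h]
    have habs : |2 * t ^ 2 - u ^ 2 - v ^ 2| ≤ 2 * (t ^ 2 + u ^ 2 + v ^ 2) :=
      abs_le.mpr ⟨by nlinarith [sq_nonneg t, sq_nonneg u, sq_nonneg v],
        by nlinarith [sq_nonneg t, sq_nonneg u, sq_nonneg v]⟩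
    have hsq : (4 * u - 2 * √2 * t) ^ 2 ≤ 32 * (t ^ 2 + u ^ 2 + v ^ 2) := by
      nlinarith [sq_nonneg (4 * u + 2 * √2 * t), sq_nonneg t, sq_nonneg v]
    rw [Real.norm_of_nonneg (by positivity)]
    calc _ ≤ (1 * exp (-t ^ 2 / 2)) * ((2 * (t ^ 2 + u ^ 2 + v ^ 2)) *
          (32 * (t ^ 2 + u ^ 2 + v ^ 2)) * exp (-(u ^ 2 + v ^ 2) / 2)) := by
          gcongr
      _ = 64 * ((t ^ 2 + u ^ 2 + v ^ 2) ^ 2 * exp (-(t ^ 2 + u ^ 2 + v ^ 2) / 2)) := by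
          rw [show -(t ^ 2 + u ^ 2 + v ^ 2) / 2 = -t ^ 2 / 2 + -(u ^ 2 + v ^ 2) / 2 by ring, exp_add]
          ring
      _ ≤ 64 * (32 * exp (-(t ^ 2 + u ^ 2 + v ^ 2) / 4)) :=
          mul_le_mul_of_nonneg_left
            (sq_mul_exp_neg_half_le (s := t ^ 2 + u ^ 2 + v ^ 2) (by positivity)) (by norm_num)
      _ = _ := by
          rw [← exp_add, ← exp_add]; ring_nf

theorem gaussDens_sumDiff (t u v : ℝ) :
    gaussDens (√2 * t + u, v, √2 * t - u) = (2 * π) ^ (-(3 : ℝ) / 2) * (8 : ℝ) ^ (-(1 : ℝ) / 2) *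
      (exp (-t ^ 2 / 2) * exp (-(u ^ 2 + v ^ 2) / 2)) := by
  have h2 : √2 ^ 2 = 2 := Real.sq_sqrt (by norm_num)
  rw [gaussDens, ← exp_add]
  congr 2
  linear_combination (-(t ^ 2) / 4) * h2

theorem sqrt_eight : √8 = 2 * √2 := by
  rw [show (8 : ℝ) = 2 ^ 2 * 2 by norm_num, Real.sqrt_mul (by norm_num), Real.sqrt_sq (by norm_num)]

theorem gaussian_normalization :
    2 * √2 * ((2 * π) ^ (-(3 : ℝ) / 2) * (8 : ℝ) ^ (-(1 : ℝ) / 2)) * (32 * π) =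
      8 * √(2 / π) := by
  have h2 : √2 ^ 2 = 2 := Real.sq_sqrt (by norm_num)
  have e8 : (8 : ℝ) ^ (-(1 : ℝ) / 2) = (√8)⁻¹ := by
    rw [neg_div, Real.rpow_neg (by norm_num), Real.sqrt_eq_rpow]
  have ep : (2 * π) ^ (-(3 : ℝ) / 2) = (2 * π * (√2 * √π))⁻¹ := by
    rw [neg_div, Real.rpow_neg (by positivity), show (3 : ℝ) / 2 = 1 + 1 / 2 by norm_num,
      Real.rpow_add (by positivity), Real.rpow_one, ← Real.sqrt_eq_rpow,
      Real.sqrt_mul (by norm_num)]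
  rw [e8, ep, sqrt_eight, Real.sqrt_div (by norm_num)]
  field_simp
  linear_combination (-16 : ℝ) * h2

theorem stmt19 (I : Set ℝ) (hI : I.OrdConnected) :
    (∫ z : ℝ × ℝ × ℝ, |z.1 * z.2.2 - z.2.1 ^ 2| * (z.1 - 3 * z.2.2) ^ 2 *
        Set.indicator I (fun _ => (1 : ℝ)) ((z.1 + z.2.2) / Real.sqrt 8) * gaussDens z) =
      8 * ∫ t in I, p2c t := by
  have hm : MeasurableSet I := hI.measurableSet
  have h2 : √2 ^ 2 = 2 := Real.sq_sqrt (by norm_num)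
  rw [integral_comp_sumDiffMap]
  have hpt : ∀ x : ℝ × ℝ × ℝ,
      |(√2 * x.1 + x.2.1) * (√2 * x.1 - x.2.1) - x.2.2 ^ 2| *
        (√2 * x.1 + x.2.1 - 3 * (√2 * x.1 - x.2.1)) ^ 2 *
        I.indicator (fun _ => (1 : ℝ)) ((√2 * x.1 + x.2.1 + (√2 * x.1 - x.2.1)) / √8) *
        gaussDens (√2 * x.1 + x.2.1, x.2.2, √2 * x.1 - x.2.1) =
      (2 * π) ^ (-(3 : ℝ) / 2) * (8 : ℝ) ^ (-(1 : ℝ) / 2) *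
        ((I.indicator (fun _ => (1 : ℝ)) x.1 * exp (-x.1 ^ 2 / 2)) *
        (|2 * x.1 ^ 2 - x.2.1 ^ 2 - x.2.2 ^ 2| * (4 * x.2.1 - 2 * √2 * x.1) ^ 2 *
          exp (-(x.2.1 ^ 2 + x.2.2 ^ 2) / 2))) := by
    intro x
    have e1 : (√2 * x.1 + x.2.1) * (√2 * x.1 - x.2.1) - x.2.2 ^ 2 =
        2 * x.1 ^ 2 - x.2.1 ^ 2 - x.2.2 ^ 2 := by linear_combination x.1 ^ 2 * h2
    have e2 : (√2 * x.1 + x.2.1 + (√2 * x.1 - x.2.1)) / √8 = x.1 := by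
      rw [sqrt_eight]; field_simp; ring
    rw [gaussDens_sumDiff, e1, e2]
    ring
  simp only [hpt]
  rw [integral_const_mul, Measure.volume_eq_prod, integral_prod _ (integrable_sumDiff hm)]
  simp_rw [integral_const_mul, integral_planar]
  rw [← integral_indicator hm, ← integral_const_mul, ← integral_const_mul, ← integral_const_mul]
  congr 1
  ext t
  by_cases ht : t ∈ I
  · simp only [indicator_of_mem ht, p2c]
    linear_combination (-4 + t ^ 2 + t ^ 4 + 2 * exp (-t ^ 2) * (4 + 3 * t ^ 2)) *
      exp (-t ^ 2 / 2) * gaussian_normalization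
  · simp [indicator_of_notMem ht]
end
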